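/- Let Λ be a finite set, give each site the doubled space ℂ² ⊗ ℂ², set R^i = ½(σ^i ⊗ 𝟙 + 𝟙 ⊗ σ^i) for i ∈ {1,3}, and let H̃_Λ = −∑_{A⊆Λ} (J¹_A ∏_{x∈A} R¹_x + J³_A ∏_{x∈A} R³_x) on H̃_Λ = ⊗_{x∈Λ}(ℂ² ⊗ ℂ²), with all J¹_A, J³_A ≥ 0. Assume that for every x ∈ Λ there exist i ∈ {1,3} and A ∋ x with J^i_A > 0. Let P^triplet be the orthogonal projector of ℂ² ⊗ ℂ² onto the symmetric (triplet) subspace and P^triplet_Λ = ⊗_{x∈Λ} P^triplet. Then every eigenvector of H̃_Λ with eigenvalue equal to the smallest eigenvalue of H̃_Λ lies in the range of P^triplet_Λ. -/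

import Mathlib

open scoped Matrix Kronecker BigOperators ComplexOrder
open NormedSpace

noncomputable section

/-- Pauli matrices -/
def pauli1 : Matrix (Fin 2) (Fin 2) ℂ := !![0, 1; 1, 0]
def pauli2 : Matrix (Fin 2) (Fin 2) ℂ := !![0, -Complex.I; Complex.I, 0]
def pauli3 : Matrix (Fin 2) (Fin 2) ℂ := !![1, 0; 0, -1]

/-- `R = ½(σ ⊗ 𝟙 + 𝟙 ⊗ σ)` on `ℂ² ⊗ ℂ²`. -/
def Rop (σ : Matrix (Fin 2) (Fin 2) ℂ) : Matrix (Fin 2 × Fin 2) (Fin 2 × Fin 2) ℂ :=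
  (1/2 : ℂ) • (σ ⊗ₖ (1 : Matrix (Fin 2) (Fin 2) ℂ) + (1 : Matrix (Fin 2) (Fin 2) ℂ) ⊗ₖ σ)

/-- the singlet vector `(|+−⟩ − |−+⟩)/√2` of `ℂ² ⊗ ℂ²` (index `0` is `|+⟩`). -/
def singlet : Fin 2 × Fin 2 → ℂ := fun p =>
  if p = (0, 1) then (Real.sqrt 2 : ℂ)⁻¹ else if p = (1, 0) then -(Real.sqrt 2 : ℂ)⁻¹ else 0

/-- the orthogonal projector of `ℂ² ⊗ ℂ²` onto the symmetric (triplet) subspace,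
i.e. onto the orthogonal complement of the singlet vector. -/
def Ptrip : Matrix (Fin 2 × Fin 2) (Fin 2 × Fin 2) ℂ :=
  1 - Matrix.vecMulVec singlet (star singlet)

variable {ι κ : Type*} [Fintype ι] [DecidableEq ι] [Fintype κ] [DecidableEq κ]

/-- The operator on `⊗_{x∈ι} ℂ^κ` acting as `σ` on every site of `A` and as the
identity on all other sites, written as a matrix in the product basis. -/
def siteProd (σ : Matrix κ κ ℂ) (A : Finset ι) : Matrix (ι → κ) (ι → κ) ℂ :=
  fun f g => (∏ x ∈ A, σ (f x) (g x)) * ∏ x ∈ Aᶜ, (if f x = g x then (1:ℂ) else 0)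

/-- The ground-state energy: the smallest real point of the spectrum. -/
def E0 {n : Type*} [Fintype n] [DecidableEq n] (M : Matrix n n ℂ) : ℝ :=
  sInf {t : ℝ | (t : ℂ) ∈ spectrum ℂ M}

/-- The hamiltonian `H̃_Λ = −∑_{A⊆Λ} (J¹_A ∏_{x∈A} R¹_x + J³_A ∏_{x∈A} R³_x)` on
`⊗_{x∈Λ} (ℂ² ⊗ ℂ²)`. -/
def hamR {ι : Type*} [Fintype ι] [DecidableEq ι] (J1 J3 : Finset ι → ℝ) :
    Matrix (ι → Fin 2 × Fin 2) (ι → Fin 2 × Fin 2) ℂ :=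
  - ∑ A : Finset ι, ((J1 A : ℂ) • siteProd (Rop pauli1) A + (J3 A : ℂ) • siteProd (Rop pauli3) A)

open Matrix

set_option linter.unusedSectionVars false

/-! ### Matrices with nonnegative entries and their top eigenvectors -/

section Perron

variable {n : Type*} [Fintype n] [DecidableEq n]

/-- The entrywise modulus of a complex vector. -/
def modulus {n : Type*} (v : n → ℂ) : n → ℂ := fun i => ((‖v i‖ : ℝ) : ℂ)

theorem modulus_nonneg {n : Type*} (v : n → ℂ) (i : n) : 0 ≤ modulus v i := by
  simp [modulus]

theorem star_modulus {n : Type*} (v : n → ℂ) : star (modulus v) = modulus v := by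
  funext i
  simp [modulus]

theorem modulus_dotProduct_self {n : Type*} [Fintype n] (v : n → ℂ) :
    star (modulus v) ⬝ᵥ modulus v = star v ⬝ᵥ v := by
  rw [star_modulus]
  refine Finset.sum_congr rfl fun i _ => ?_
  simp only [modulus, Pi.star_apply, RCLike.star_def]
  rw [Complex.conj_mul', sq]

theorem norm_form_le {n : Type*} [Fintype n] {A : Matrix n n ℂ} (hA : ∀ i j, 0 ≤ A i j)
    (v : n → ℂ) :
    ((‖star v ⬝ᵥ A *ᵥ v‖ : ℝ) : ℂ) ≤ star (modulus v) ⬝ᵥ A *ᵥ modulus v := by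
  have hform : star (modulus v) ⬝ᵥ A *ᵥ modulus v =
      ((∑ i, ‖v i‖ * ∑ j, ‖A i j‖ * ‖v j‖ : ℝ) : ℂ) := by
    rw [star_modulus]
    simp only [dotProduct, mulVec, modulus]
    push_cast
    refine Finset.sum_congr rfl fun i _ => ?_
    congr 1
    refine Finset.sum_congr rfl fun j _ => ?_
    rw [← Complex.eq_coe_norm_of_nonneg (hA i j)]
  rw [hform, Complex.real_le_real]
  simp only [dotProduct, mulVec]
  refine (norm_sum_le _ _).trans (Finset.sum_le_sum fun i _ => ?_)
  rw [norm_mul, Pi.star_apply, norm_star]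
  refine mul_le_mul_of_nonneg_left ((norm_sum_le _ _).trans (le_of_eq ?_)) (norm_nonneg _)
  exact Finset.sum_congr rfl fun j _ => norm_mul _ _

theorem form_nonneg {n : Type*} [Fintype n] {A : Matrix n n ℂ} (hA : ∀ i j, 0 ≤ A i j)
    {u : n → ℂ} (hu : ∀ i, 0 ≤ u i) : 0 ≤ star u ⬝ᵥ A *ᵥ u :=
  Finset.sum_nonneg fun i _ => mul_nonneg (star_nonneg_iff.2 (hu i))
    (Finset.sum_nonneg fun j _ => mul_nonneg (hA i j) (hu j))

theorem form_smul_one_sub (l : ℝ) (M : Matrix n n ℂ) (u : n → ℂ) :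
    star u ⬝ᵥ ((l : ℂ) • (1 : Matrix n n ℂ) - M) *ᵥ u =
      (l : ℂ) * (star u ⬝ᵥ u) - star u ⬝ᵥ M *ᵥ u := by
  simp [sub_mulVec, smul_mulVec, dotProduct_sub]

/-- A vector attaining the top of the quadratic form is an eigenvector. -/
theorem eigenvector_of_le_form {M : Matrix n n ℂ} {l : ℝ}
    (hM : ((l : ℂ) • (1 : Matrix n n ℂ) - M).PosSemidef) {u : n → ℂ}
    (h : (l : ℂ) * (star u ⬝ᵥ u) ≤ star u ⬝ᵥ M *ᵥ u) : M *ᵥ u = (l : ℂ) • u := by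
  have h0 := hM.dotProduct_mulVec_nonneg u
  have h1 : star u ⬝ᵥ ((l : ℂ) • (1 : Matrix n n ℂ) - M) *ᵥ u = 0 := by
    refine le_antisymm ?_ h0
    rw [form_smul_one_sub]
    exact sub_nonpos.2 h
  rw [hM.dotProduct_mulVec_zero_iff, sub_mulVec, smul_mulVec, one_mulVec, sub_eq_zero] at h1
  exact h1.symm

theorem form_le {M : Matrix n n ℂ} {l : ℝ}
    (hM : ((l : ℂ) • (1 : Matrix n n ℂ) - M).PosSemidef) (u : n → ℂ) :
    star u ⬝ᵥ M *ᵥ u ≤ (l : ℂ) * (star u ⬝ᵥ u) := by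
  have h0 := hM.dotProduct_mulVec_nonneg u
  rw [form_smul_one_sub] at h0
  exact sub_nonneg.1 h0

theorem le_norm_form_of_eigenvector {n : Type*} [Fintype n] {M : Matrix n n ℂ} {l : ℝ}
    {u : n → ℂ} (hu : M *ᵥ u = (l : ℂ) • u) :
    (l : ℂ) * (star u ⬝ᵥ u) ≤ ((‖star u ⬝ᵥ M *ᵥ u‖ : ℝ) : ℂ) := by
  rw [hu, dotProduct_smul, smul_eq_mul, norm_mul]
  have h := Complex.eq_coe_norm_of_nonneg (dotProduct_star_self_nonneg u)
  rw [Complex.ofReal_mul, ← h]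
  refine mul_le_mul_of_nonneg_right ?_ ?_
  · rw [Complex.real_le_real, Complex.norm_real]
    exact le_abs_self l
  · rw [h]
    exact_mod_cast norm_nonneg _

theorem eigenvector_modulus {M : Matrix n n ℂ} (hM0 : ∀ i j, 0 ≤ M i j) {l : ℝ}
    (hM : ((l : ℂ) • (1 : Matrix n n ℂ) - M).PosSemidef) {u : n → ℂ}
    (hu : M *ᵥ u = (l : ℂ) • u) : M *ᵥ modulus u = (l : ℂ) • modulus u := by
  refine eigenvector_of_le_form hM ?_
  rw [modulus_dotProduct_self]
  exact (le_norm_form_of_eigenvector hu).trans (norm_form_le hM0 u)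

theorem posSemidef_of_entries_le {M N : Matrix n n ℂ} (hN0 : ∀ i j, 0 ≤ N i j)
    (hNM : ∀ i j, 0 ≤ (M - N) i j) (hN : N.IsHermitian) {l : ℝ}
    (hM : ((l : ℂ) • (1 : Matrix n n ℂ) - M).PosSemidef) :
    ((l : ℂ) • (1 : Matrix n n ℂ) - N).PosSemidef := by
  have hherm : ((l : ℂ) • (1 : Matrix n n ℂ) - N).IsHermitian := by
    refine IsHermitian.sub ?_ hN
    rw [IsHermitian, conjTranspose_smul, conjTranspose_one]
    simp
  refine .of_dotProduct_mulVec_nonneg hherm fun u => ?_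
  rw [form_smul_one_sub, sub_nonneg]
  have h1 := form_nonneg hNM (modulus_nonneg u)
  rw [sub_mulVec, dotProduct_sub, sub_nonneg] at h1
  have h2 := ((norm_form_le hN0 u).trans h1).trans (form_le hM _)
  rw [modulus_dotProduct_self] at h2
  refine le_trans ?_ h2
  have h3 : star u ⬝ᵥ N *ᵥ u = (((star u ⬝ᵥ N *ᵥ u).re : ℝ) : ℂ) :=
    Complex.ext rfl (hN.im_star_dotProduct_mulVec_self u)
  rw [h3, Complex.real_le_real, Complex.norm_real]
  exact le_abs_self _

theorem eigenvector_of_entries_le {M N : Matrix n n ℂ}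
    (hNM : ∀ i j, 0 ≤ (M - N) i j) {l : ℝ}
    (hM : ((l : ℂ) • (1 : Matrix n n ℂ) - M).PosSemidef) {u : n → ℂ} (hu0 : ∀ i, 0 ≤ u i)
    (hu : N *ᵥ u = (l : ℂ) • u) : M *ᵥ u = (l : ℂ) • u := by
  refine eigenvector_of_le_form hM ?_
  have h1 := form_nonneg hNM hu0
  rw [sub_mulVec, dotProduct_sub, sub_nonneg, hu, dotProduct_smul] at h1
  exact h1

end Perron

/-! ### A correlation inequality in the top eigenspace -/

section Correlation

variable {n m : Type*} [Fintype n] [DecidableEq n] [Fintype m] [DecidableEq m]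

/-- `A ⊗ 𝟙 + 𝟙 ⊗ A`. -/
def doubleAdd {n : Type*} [DecidableEq n] (A : Matrix n n ℂ) : Matrix (n × n) (n × n) ℂ :=
  A ⊗ₖ (1 : Matrix n n ℂ) + (1 : Matrix n n ℂ) ⊗ₖ A

/-- `A ⊗ 𝟙 - 𝟙 ⊗ A`. -/
def doubleSub {n : Type*} [DecidableEq n] (A : Matrix n n ℂ) : Matrix (n × n) (n × n) ℂ :=
  A ⊗ₖ (1 : Matrix n n ℂ) - (1 : Matrix n n ℂ) ⊗ₖ A

/-- In the coordinates of the doubled space given by `W`, the matrices `A ⊗ 𝟙 + 𝟙 ⊗ A` and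
`ε (A ⊗ 𝟙 - 𝟙 ⊗ A)` have nonnegative entries. -/
def IsFerro {n m : Type*} [Fintype n] [DecidableEq n] (W : Matrix m (n × n) ℂ) (ε : ℂ)
    (A : Matrix n n ℂ) : Prop :=
  (∀ i j, 0 ≤ (W * doubleAdd A * Wᴴ) i j) ∧ ∀ i j, 0 ≤ (ε • (W * doubleSub A * Wᴴ)) i j

theorem mul_entries_nonneg {m : Type*} [Fintype m] {A B : Matrix m m ℂ}
    (hA : ∀ i j, 0 ≤ A i j) (hB : ∀ i j, 0 ≤ B i j) (i j : m) : 0 ≤ (A * B) i j :=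
  Finset.sum_nonneg fun k _ => mul_nonneg (hA i k) (hB k j)

theorem doubleAdd_mul (A B : Matrix n n ℂ) :
    doubleAdd (A * B) =
      (1 / 2 : ℂ) • (doubleAdd A * doubleAdd B + doubleSub A * doubleSub B) := by
  simp only [doubleAdd, doubleSub, mul_add, add_mul, mul_sub, sub_mul, ← mul_kronecker_mul,
    mul_one, one_mul]
  module

theorem doubleSub_mul (A B : Matrix n n ℂ) :
    doubleSub (A * B) =
      (1 / 2 : ℂ) • (doubleAdd A * doubleSub B + doubleSub A * doubleAdd B) := by
  simp only [doubleAdd, doubleSub, mul_add, add_mul, mul_sub, sub_mul, ← mul_kronecker_mul,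
    mul_one, one_mul]
  module

theorem isometry_conj_mul {W : Matrix m (n × n) ℂ} (hW : Wᴴ * W = 1)
    (X Y : Matrix (n × n) (n × n) ℂ) :
    W * (X * Y) * Wᴴ = (W * X * Wᴴ) * (W * Y * Wᴴ) := by
  calc W * (X * Y) * Wᴴ = W * X * (1 : Matrix (n × n) (n × n) ℂ) * (Y * Wᴴ) := by
        simp only [Matrix.mul_one, Matrix.mul_assoc]
    _ = _ := by rw [← hW]; simp only [Matrix.mul_assoc]

theorem half_nonneg_complex : (0 : ℂ) ≤ 1 / 2 := by
  rw [show (1 / 2 : ℂ) = ((1 / 2 : ℝ) : ℂ) by push_cast; rfl]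
  exact_mod_cast (by norm_num : (0 : ℝ) ≤ 1 / 2)

theorem IsFerro.mul {W : Matrix m (n × n) ℂ} (hW : Wᴴ * W = 1) {ε : ℂ} (hε : ε * ε = 1)
    {A B : Matrix n n ℂ} (hA : IsFerro W ε A) (hB : IsFerro W ε B) : IsFerro W ε (A * B) := by
  constructor
  · have h : W * doubleAdd (A * B) * Wᴴ =
        (1 / 2 : ℂ) • ((W * doubleAdd A * Wᴴ) * (W * doubleAdd B * Wᴴ) +
          (ε • (W * doubleSub A * Wᴴ)) * (ε • (W * doubleSub B * Wᴴ))) := by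
      rw [doubleAdd_mul, smul_mul_smul_comm, hε, one_smul, ← isometry_conj_mul hW,
        ← isometry_conj_mul hW]
      simp only [Matrix.mul_smul, Matrix.smul_mul, Matrix.mul_add, Matrix.add_mul]
    intro i j
    rw [h]
    exact mul_nonneg half_nonneg_complex (add_nonneg (mul_entries_nonneg hA.1 hB.1 i j)
      (mul_entries_nonneg hA.2 hB.2 i j))
  · have h : ε • (W * doubleSub (A * B) * Wᴴ) =
        (1 / 2 : ℂ) • ((W * doubleAdd A * Wᴴ) * (ε • (W * doubleSub B * Wᴴ)) +
          (ε • (W * doubleSub A * Wᴴ)) * (W * doubleAdd B * Wᴴ)) := by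
      rw [doubleSub_mul, Matrix.mul_smul (W * doubleAdd A * Wᴴ),
        Matrix.smul_mul _ (W * doubleSub A * Wᴴ), ← isometry_conj_mul hW, ← isometry_conj_mul hW]
      simp only [Matrix.mul_smul, Matrix.smul_mul, Matrix.mul_add, Matrix.add_mul, smul_add,
        smul_comm ε]
    intro i j
    rw [h]
    exact mul_nonneg half_nonneg_complex (add_nonneg (mul_entries_nonneg hA.1 hB.2 i j)
      (mul_entries_nonneg hA.2 hB.1 i j))

theorem form_conj {m n : Type*} [Fintype m] [Fintype n] (W : Matrix m n ℂ) (X : Matrix n n ℂ)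
    (v : m → ℂ) : star v ⬝ᵥ (W * X * Wᴴ) *ᵥ v = star (Wᴴ *ᵥ v) ⬝ᵥ X *ᵥ (Wᴴ *ᵥ v) := by
  rw [star_mulVec, conjTranspose_conjTranspose, ← mulVec_mulVec, ← mulVec_mulVec,
    ← dotProduct_mulVec]

theorem kronecker_one_mulVec (A : Matrix n n ℂ) (v : n × n → ℂ) (p : n × n) :
    ((A ⊗ₖ (1 : Matrix n n ℂ)) *ᵥ v) p = (A *ᵥ fun i => v (i, p.2)) p.1 := by
  simp [mulVec, dotProduct, Fintype.sum_prod_type, one_apply]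

theorem one_kronecker_mulVec (A : Matrix n n ℂ) (v : n × n → ℂ) (p : n × n) :
    (((1 : Matrix n n ℂ) ⊗ₖ A) *ᵥ v) p = (A *ᵥ fun j => v (p.1, j)) p.2 := by
  simp [mulVec, dotProduct, Fintype.sum_prod_type, one_apply]

theorem kronecker_mulVec_prod {n : Type*} [Fintype n] (A B : Matrix n n ℂ) (u v : n → ℂ) :
    (A ⊗ₖ B) *ᵥ (fun p : n × n => u p.1 * v p.2) = fun p => (A *ᵥ u) p.1 * (B *ᵥ v) p.2 := by
  funext p
  simp only [mulVec, dotProduct, Fintype.sum_prod_type, kroneckerMap_apply, Finset.sum_mul_sum]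
  exact Finset.sum_congr rfl fun i _ => Finset.sum_congr rfl fun j _ => by ring

theorem form_conjTranspose_mul_self {n : Type*} [Fintype n] (A : Matrix n n ℂ) (v : n → ℂ) :
    star v ⬝ᵥ (Aᴴ * A) *ᵥ v = star (A *ᵥ v) ⬝ᵥ A *ᵥ v := by
  rw [star_mulVec, ← mulVec_mulVec, ← dotProduct_mulVec]

theorem IsFerro.exists_mul_mulVec_ne_zero {W : Matrix m (n × n) ℂ} (hW : Wᴴ * W = 1)
    (hW' : W * Wᴴ = 1) {ε : ℂ} (hε : ε * ε = 1) {N B C : Matrix n n ℂ}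
    (hN0 : ∀ i j, 0 ≤ (W * doubleAdd N * Wᴴ) i j) {l : ℝ}
    (hN : ((l : ℂ) • (1 : Matrix n n ℂ) - N).PosSemidef) (hB : IsFerro W ε B)
    (hC : IsFerro W ε C) (hBh : B.IsHermitian) (hCh : C.IsHermitian) (hBC : B * C = C * B)
    {u v : n → ℂ} (hu : N *ᵥ u = (l : ℂ) • u) (hv : N *ᵥ v = (l : ℂ) • v)
    (hBu : B *ᵥ u ≠ 0) (hCv : C *ᵥ v ≠ 0) :
    ∃ t, N *ᵥ t = (l : ℂ) • t ∧ (B * C) *ᵥ t ≠ 0 := by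
  by_contra! hcon
  have hsq : ∀ t, N *ᵥ t = (l : ℂ) • t → (B * B * (C * C)) *ᵥ t = 0 := fun t ht => by
    have : B * B * (C * C) = B * C * (B * C) := by
      rw [Matrix.mul_assoc B B, Matrix.mul_assoc B C, ← Matrix.mul_assoc B C C, hBC,
        Matrix.mul_assoc C B C, hBC]
    rw [this, ← mulVec_mulVec, hcon t ht, mulVec_zero]
  set K := (l : ℂ) • (1 : Matrix n n ℂ) - N with hK
  have hK1 : (K ⊗ₖ (1 : Matrix n n ℂ)).PosSemidef := hN.kronecker PosSemidef.one
  have hK2 : ((1 : Matrix n n ℂ) ⊗ₖ K).PosSemidef := PosSemidef.one.kronecker hN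
  have hsum : ((2 * l : ℝ) : ℂ) • (1 : Matrix (n × n) (n × n) ℂ) - doubleAdd N =
      K ⊗ₖ (1 : Matrix n n ℂ) + (1 : Matrix n n ℂ) ⊗ₖ K := by
    have h1 : K ⊗ₖ (1 : Matrix n n ℂ) = (l : ℂ) • 1 - N ⊗ₖ (1 : Matrix n n ℂ) := by
      rw [hK, sub_eq_add_neg, add_kronecker, smul_kronecker, one_kronecker_one, ← neg_one_smul ℂ,
        smul_kronecker]
      module
    have h2 : (1 : Matrix n n ℂ) ⊗ₖ K = (l : ℂ) • 1 - (1 : Matrix n n ℂ) ⊗ₖ N := by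
      rw [hK, sub_eq_add_neg, kronecker_add, kronecker_smul, one_kronecker_one, ← neg_one_smul ℂ,
        kronecker_smul]
      module
    rw [h1, h2, doubleAdd]
    push_cast
    module
  have hD : (((2 * l : ℝ) : ℂ) • (1 : Matrix m m ℂ) - W * doubleAdd N * Wᴴ).PosSemidef := by
    have : ((2 * l : ℝ) : ℂ) • (1 : Matrix m m ℂ) - W * doubleAdd N * Wᴴ =
        W * (((2 * l : ℝ) : ℂ) • (1 : Matrix (n × n) (n × n) ℂ) - doubleAdd N) * Wᴴ := by
      rw [Matrix.mul_sub, Matrix.sub_mul, Matrix.mul_smul, Matrix.smul_mul, Matrix.mul_one, hW']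
    rw [this, hsum]
    exact (hK1.add hK2).mul_mul_conjTranspose_same W
  set G := doubleSub (B * B) * doubleSub (C * C) with hG
  have hG0 : ∀ i j, 0 ≤ (W * G * Wᴴ) i j := by
    have : W * G * Wᴴ =
        (ε • (W * doubleSub (B * B) * Wᴴ)) * (ε • (W * doubleSub (C * C) * Wᴴ)) := by
      rw [smul_mul_smul_comm, hε, one_smul, ← isometry_conj_mul hW]
    rw [this]
    exact mul_entries_nonneg (hB.mul hW hε hB).2 (hC.mul hW hε hC).2
  have hker : ∀ t : n × n → ℂ, (K ⊗ₖ (1 : Matrix n n ℂ)) *ᵥ t = 0 →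
      ((1 : Matrix n n ℂ) ⊗ₖ K) *ᵥ t = 0 →
      star t ⬝ᵥ G *ᵥ t = -(star ((B ⊗ₖ C) *ᵥ t) ⬝ᵥ (B ⊗ₖ C) *ᵥ t +
        star ((C ⊗ₖ B) *ᵥ t) ⬝ᵥ (C ⊗ₖ B) *ᵥ t) := by
    intro t h1 h2
    have e1 : ((B * B * (C * C)) ⊗ₖ (1 : Matrix n n ℂ)) *ᵥ t = 0 := by
      funext p
      rw [kronecker_one_mulVec, hsq]
      · rfl
      · funext i
        have := congrFun h1 (i, p.2)
        rw [kronecker_one_mulVec, hK, sub_mulVec, smul_mulVec, one_mulVec] at this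
        exact (sub_eq_zero.1 this).symm
    have e2 : ((1 : Matrix n n ℂ) ⊗ₖ (B * B * (C * C))) *ᵥ t = 0 := by
      funext p
      rw [one_kronecker_mulVec, hsq]
      · rfl
      · funext i
        have := congrFun h2 (p.1, i)
        rw [one_kronecker_mulVec, hK, sub_mulVec, smul_mulVec, one_mulVec] at this
        exact (sub_eq_zero.1 this).symm
    have e3 : G = (B * B * (C * C)) ⊗ₖ (1 : Matrix n n ℂ) +
        (1 : Matrix n n ℂ) ⊗ₖ (B * B * (C * C)) -
        ((B ⊗ₖ C)ᴴ * (B ⊗ₖ C) + (C ⊗ₖ B)ᴴ * (C ⊗ₖ B)) := by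
      rw [conjTranspose_kronecker, conjTranspose_kronecker, hBh.eq, hCh.eq]
      simp only [hG, doubleSub, mul_sub, sub_mul, ← mul_kronecker_mul, mul_one, one_mul]
      abel
    rw [e3, sub_mulVec, add_mulVec, e1, e2, dotProduct_sub, add_mulVec, dotProduct_add,
      dotProduct_add,
      form_conjTranspose_mul_self, form_conjTranspose_mul_self]
    simp
  have hsq_nonneg : ∀ X : Matrix (n × n) (n × n) ℂ, ∀ t, 0 ≤ star (X *ᵥ t) ⬝ᵥ X *ᵥ t :=
    fun X t => dotProduct_star_self_nonneg _
  set η : n × n → ℂ := fun p => u p.1 * v p.2 with hη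
  have hKu : K *ᵥ u = 0 := by rw [hK, sub_mulVec, smul_mulVec, one_mulVec, hu, sub_self]
  have hKv : K *ᵥ v = 0 := by rw [hK, sub_mulVec, smul_mulVec, one_mulVec, hv, sub_self]
  have hη1 : (K ⊗ₖ (1 : Matrix n n ℂ)) *ᵥ η = 0 := by
    rw [hη, kronecker_mulVec_prod, hKu]
    funext p
    simp
  have hη2 : ((1 : Matrix n n ℂ) ⊗ₖ K) *ᵥ η = 0 := by
    rw [hη, kronecker_mulVec_prod, hKv]
    funext p
    simp
  have hηN : doubleAdd N *ᵥ η = ((2 * l : ℝ) : ℂ) • η := by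
    have h : (((2 * l : ℝ) : ℂ) • (1 : Matrix (n × n) (n × n) ℂ) - doubleAdd N) *ᵥ η = 0 := by
      rw [hsum, add_mulVec, hη1, hη2, add_zero]
    rw [sub_mulVec, smul_mulVec, one_mulVec] at h
    exact (sub_eq_zero.1 h).symm
  have hback : Wᴴ *ᵥ (W *ᵥ η) = η := by rw [mulVec_mulVec, hW, one_mulVec]
  have hΨ : (W * doubleAdd N * Wᴴ) *ᵥ (W *ᵥ η) = ((2 * l : ℝ) : ℂ) • (W *ᵥ η) := by
    rw [← mulVec_mulVec, ← mulVec_mulVec, hback, hηN, mulVec_smul]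
  set t := Wᴴ *ᵥ modulus (W *ᵥ η) with ht
  have htop := eigenvector_modulus hN0 hD hΨ
  have htK : star t ⬝ᵥ (K ⊗ₖ (1 : Matrix n n ℂ)) *ᵥ t +
      star t ⬝ᵥ ((1 : Matrix n n ℂ) ⊗ₖ K) *ᵥ t = 0 := by
    rw [← dotProduct_add, ← add_mulVec, ← hsum, form_smul_one_sub, ← form_conj, htop,
      dotProduct_smul, smul_eq_mul, sub_eq_zero, ht]
    congr 1
    rw [star_mulVec, conjTranspose_conjTranspose, ← dotProduct_mulVec, mulVec_mulVec, hW',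
      one_mulVec]
  obtain ⟨ht1, ht2⟩ := (add_eq_zero_iff_of_nonneg (hK1.dotProduct_mulVec_nonneg t)
    (hK2.dotProduct_mulVec_nonneg t)).1 htK
  rw [hK1.dotProduct_mulVec_zero_iff] at ht1
  rw [hK2.dotProduct_mulVec_zero_iff] at ht2
  have hle := norm_form_le hG0 (W *ᵥ η)
  rw [form_conj, form_conj, hback, ← ht, hker t ht1 ht2] at hle
  have hzero : star η ⬝ᵥ G *ᵥ η = 0 := by
    have h := hle.trans (neg_nonpos.2 (add_nonneg (hsq_nonneg (B ⊗ₖ C) t)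
      (hsq_nonneg (C ⊗ₖ B) t)))
    have h' : ‖star η ⬝ᵥ G *ᵥ η‖ ≤ 0 := by exact_mod_cast h
    exact norm_le_zero_iff.1 h'
  rw [hker η hη1 hη2, neg_eq_zero, add_eq_zero_iff_of_nonneg (hsq_nonneg _ _)
    (hsq_nonneg _ _), dotProduct_star_self_eq_zero, hη, kronecker_mulVec_prod] at hzero
  obtain ⟨i, hi⟩ := Function.ne_iff.1 hBu
  obtain ⟨j, hj⟩ := Function.ne_iff.1 hCv
  exact mul_ne_zero hi hj (congrFun hzero.1 (i, j))

end Correlation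

/-! ### Product operators -/

section Tensor

/-- The matrix of `⊗ₓ M x` in the product basis. -/
def tensor {ι κ : Type*} [Fintype ι] (M : ι → Matrix κ κ ℂ) : Matrix (ι → κ) (ι → κ) ℂ :=
  fun f g => ∏ x, M x (f x) (g x)

theorem tensor_mul (M N : ι → Matrix κ κ ℂ) :
    tensor M * tensor N = tensor fun x => M x * N x := by
  ext f g
  simp only [tensor, mul_apply, ← Finset.prod_mul_distrib]
  rw [Finset.prod_univ_sum, Fintype.piFinset_univ]

theorem tensor_conjTranspose {ι κ : Type*} [Fintype ι] (M : ι → Matrix κ κ ℂ) :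
    (tensor M)ᴴ = tensor fun x => (M x)ᴴ := by
  ext f g
  simp [tensor, conjTranspose_apply]

theorem siteProd_eq_tensor (σ : Matrix κ κ ℂ) (A : Finset ι) :
    siteProd σ A = tensor fun x => if x ∈ A then σ else 1 := by
  ext f g
  rw [siteProd, tensor, ← Finset.prod_mul_prod_compl A]
  congr 1
  · exact Finset.prod_congr rfl fun x hx => by rw [if_pos hx]
  · exact Finset.prod_congr rfl fun x hx => by
      rw [if_neg (Finset.mem_compl.1 hx), one_apply]

theorem tensor_one : tensor (fun _ : ι => (1 : Matrix κ κ ℂ)) = 1 := by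
  ext f g
  simp only [tensor, one_apply, Finset.prod_ite_zero, Finset.prod_const_one, funext_iff,
    Finset.mem_univ, true_implies]

theorem siteProd_empty (σ : Matrix κ κ ℂ) : siteProd σ (∅ : Finset ι) = 1 := by
  simp [siteProd_eq_tensor, tensor_one]

theorem siteProd_mul (σ τ : Matrix κ κ ℂ) (A : Finset ι) :
    siteProd (σ * τ) A = siteProd σ A * siteProd τ A := by
  simp only [siteProd_eq_tensor, tensor_mul]
  congr 1
  funext x
  split_ifs <;> simp

theorem siteProd_union (σ : Matrix κ κ ℂ) {A B : Finset ι} (h : Disjoint A B) :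
    siteProd σ (A ∪ B) = siteProd σ A * siteProd σ B := by
  simp only [siteProd_eq_tensor, tensor_mul]
  congr 1
  funext x
  have : x ∈ A → x ∉ B := fun hA => Finset.disjoint_left.1 h hA
  by_cases hA : x ∈ A <;> by_cases hB : x ∈ B <;> simp_all

theorem siteProd_insert (σ : Matrix κ κ ℂ) {A : Finset ι} {x : ι} (h : x ∉ A) :
    siteProd σ (insert x A) = siteProd σ {x} * siteProd σ A := by
  rw [Finset.insert_eq, siteProd_union σ (Finset.disjoint_singleton_left.2 h)]

theorem siteProd_erase (σ : Matrix κ κ ℂ) {A : Finset ι} {x : ι} (h : x ∈ A) :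
    siteProd σ A = siteProd σ {x} * siteProd σ (A.erase x) := by
  rw [← siteProd_insert σ (Finset.notMem_erase x A), Finset.insert_erase h]

theorem siteProd_commute_of_disjoint (σ τ : Matrix κ κ ℂ) {A B : Finset ι} (h : Disjoint A B) :
    siteProd σ A * siteProd τ B = siteProd τ B * siteProd σ A := by
  simp only [siteProd_eq_tensor, tensor_mul]
  congr 1
  funext x
  have : x ∈ A → x ∉ B := fun hA => Finset.disjoint_left.1 h hA
  by_cases hA : x ∈ A <;> by_cases hB : x ∈ B <;> simp_all

theorem siteProd_add (σ τ : Matrix κ κ ℂ) (x : ι) :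
    siteProd (σ + τ) {x} = siteProd σ {x} + siteProd τ {x} := by
  ext f g
  simp [siteProd, add_mul]

theorem siteProd_smul (c : ℂ) (σ : Matrix κ κ ℂ) (x : ι) :
    siteProd (c • σ) {x} = c • siteProd σ {x} := by
  ext f g
  simp [siteProd, mul_assoc]

theorem siteProd_one (A : Finset ι) : siteProd (1 : Matrix κ κ ℂ) A = 1 := by
  simp [siteProd_eq_tensor, tensor_one]

theorem siteProd_sub (σ τ : Matrix κ κ ℂ) (x : ι) :
    siteProd (σ - τ) {x} = siteProd σ {x} - siteProd τ {x} := by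
  ext f g
  simp [siteProd, sub_mul]

theorem siteProd_isHermitian {σ : Matrix κ κ ℂ} (h : σ.IsHermitian) (A : Finset ι) :
    (siteProd σ A).IsHermitian := by
  rw [IsHermitian, siteProd_eq_tensor, tensor_conjTranspose]
  congr 1
  funext x
  split_ifs
  · exact h
  · exact conjTranspose_one

theorem siteProd_nonneg {σ : Matrix κ κ ℂ} (h : ∀ p q, 0 ≤ σ p q) (A : Finset ι)
    (f g : ι → κ) : 0 ≤ siteProd σ A f g :=
  mul_nonneg (Finset.prod_nonneg fun _ _ => h _ _)
    (Finset.prod_nonneg fun _ _ => by split_ifs <;> simp)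

theorem tensor_conj_siteProd {w : Matrix κ κ ℂ} (hw : w * wᴴ = 1) (σ : Matrix κ κ ℂ)
    (A : Finset ι) :
    tensor (fun _ => w) * siteProd σ A * (tensor fun _ => w)ᴴ = siteProd (w * σ * wᴴ) A := by
  simp only [siteProd_eq_tensor, tensor_conjTranspose, tensor_mul]
  congr 1
  funext x
  split_ifs
  · rfl
  · rw [Matrix.mul_one, hw]

/-- The matrix `w` at every site, with the columns indexed by pairs of configurations. -/
def doubleTensor (ι : Type*) {κ : Type*} [Fintype ι] (w : Matrix (κ × κ) (κ × κ) ℂ) :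
    Matrix (ι → κ × κ) ((ι → κ) × (ι → κ)) ℂ :=
  (tensor fun _ => w).submatrix id (Equiv.arrowProdEquivProdArrow ι (fun _ => κ) fun _ => κ).symm

theorem tensor_kronecker {ι κ : Type*} [Fintype ι] (M N : ι → Matrix κ κ ℂ) :
    tensor M ⊗ₖ tensor N = (tensor fun x => M x ⊗ₖ N x).submatrix
      (Equiv.arrowProdEquivProdArrow ι (fun _ => κ) fun _ => κ).symm
      (Equiv.arrowProdEquivProdArrow ι (fun _ => κ) fun _ => κ).symm := by
  ext p q
  simp [tensor, Finset.prod_mul_distrib, Equiv.arrowProdEquivProdArrow]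

theorem doubleTensor_conj (w : Matrix (κ × κ) (κ × κ) ℂ) (M N : ι → Matrix κ κ ℂ) :
    doubleTensor ι w * (tensor M ⊗ₖ tensor N) * (doubleTensor ι w)ᴴ =
      tensor fun x => w * (M x ⊗ₖ N x) * wᴴ := by
  rw [tensor_kronecker, doubleTensor, conjTranspose_submatrix, submatrix_mul_equiv,
    submatrix_mul_equiv, submatrix_id_id, tensor_conjTranspose, tensor_mul, tensor_mul]

theorem doubleTensor_mul_conjTranspose {w : Matrix (κ × κ) (κ × κ) ℂ} (hw : w * wᴴ = 1) :
    doubleTensor ι w * (doubleTensor ι w)ᴴ = 1 := by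
  rw [doubleTensor, conjTranspose_submatrix, submatrix_mul_equiv, submatrix_id_id,
    tensor_conjTranspose, tensor_mul]
  simp only [hw, tensor_one]

theorem doubleTensor_conjTranspose_mul {w : Matrix (κ × κ) (κ × κ) ℂ} (hw : wᴴ * w = 1) :
    (doubleTensor ι w)ᴴ * doubleTensor ι w = 1 := by
  have h := submatrix_mul_equiv (tensor fun _ : ι => w)ᴴ (tensor fun _ : ι => w)
    (Equiv.arrowProdEquivProdArrow ι (fun _ => κ) fun _ => κ).symm (Equiv.refl _)
    (Equiv.arrowProdEquivProdArrow ι (fun _ => κ) fun _ => κ).symm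
  rw [tensor_conjTranspose, tensor_mul] at h
  simp only [hw, tensor_one, submatrix_one_equiv] at h
  rw [doubleTensor, conjTranspose_submatrix, tensor_conjTranspose]
  exact h

theorem doubleTensor_conj_left {w : Matrix (κ × κ) (κ × κ) ℂ} (hw : w * wᴴ = 1)
    (σ : Matrix κ κ ℂ) (A : Finset ι) :
    doubleTensor ι w * (siteProd σ A ⊗ₖ (1 : Matrix (ι → κ) (ι → κ) ℂ)) * (doubleTensor ι w)ᴴ =
      siteProd (w * (σ ⊗ₖ (1 : Matrix κ κ ℂ)) * wᴴ) A := by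
  rw [siteProd_eq_tensor, siteProd_eq_tensor, ← tensor_one, doubleTensor_conj]
  congr 1
  funext x
  split_ifs
  · rfl
  · rw [one_kronecker_one, Matrix.mul_one, hw]

theorem doubleTensor_conj_right {w : Matrix (κ × κ) (κ × κ) ℂ} (hw : w * wᴴ = 1)
    (σ : Matrix κ κ ℂ) (A : Finset ι) :
    doubleTensor ι w * ((1 : Matrix (ι → κ) (ι → κ) ℂ) ⊗ₖ siteProd σ A) * (doubleTensor ι w)ᴴ =
      siteProd (w * ((1 : Matrix κ κ ℂ) ⊗ₖ σ) * wᴴ) A := by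
  rw [siteProd_eq_tensor, siteProd_eq_tensor, ← tensor_one, doubleTensor_conj]
  congr 1
  funext x
  split_ifs
  · rfl
  · rw [one_kronecker_one, Matrix.mul_one, hw]

theorem IsFerro.siteProd_singleton {w : Matrix (κ × κ) (κ × κ) ℂ} (hw : w * wᴴ = 1) {ε : ℂ}
    {σ : Matrix κ κ ℂ} (h : IsFerro w ε σ) (x : ι) :
    IsFerro (doubleTensor ι w) ε (siteProd σ {x}) := by
  constructor
  · rw [doubleAdd, Matrix.mul_add, Matrix.add_mul, doubleTensor_conj_left hw,
      doubleTensor_conj_right hw, ← siteProd_add, ← Matrix.add_mul, ← Matrix.mul_add]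
    exact siteProd_nonneg h.1 _
  · rw [doubleSub, Matrix.mul_sub, Matrix.sub_mul, doubleTensor_conj_left hw,
      doubleTensor_conj_right hw, ← siteProd_sub, ← Matrix.sub_mul, ← Matrix.mul_sub,
      ← siteProd_smul]
    exact siteProd_nonneg h.2 _

theorem IsFerro.one {n m : Type*} [Fintype n] [DecidableEq n] [DecidableEq m]
    {W : Matrix m (n × n) ℂ} (hW : W * Wᴴ = 1) (ε : ℂ) : IsFerro W ε (1 : Matrix n n ℂ) := by
  constructor
  · intro i j
    rw [doubleAdd, one_kronecker_one, Matrix.mul_add, Matrix.add_mul, Matrix.mul_one, hW]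
    have h : 0 ≤ (1 : Matrix m m ℂ) i j := by
      rw [one_apply]
      split_ifs <;> simp
    exact add_nonneg h h
  · intro i j
    simp [doubleSub]

theorem IsFerro.siteProd {w : Matrix (κ × κ) (κ × κ) ℂ} (hw : w * wᴴ = 1) (hw' : wᴴ * w = 1)
    {ε : ℂ} (hε : ε * ε = 1) {σ : Matrix κ κ ℂ} (h : IsFerro w ε σ) (A : Finset ι) :
    IsFerro (doubleTensor ι w) ε (siteProd σ A) := by
  induction A using Finset.induction_on with
  | empty =>
    rw [siteProd_empty]
    exact IsFerro.one (doubleTensor_mul_conjTranspose hw) ε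
  | insert x A hx ih =>
    rw [siteProd_insert σ hx]
    exact (h.siteProd_singleton hw x).mul (doubleTensor_conjTranspose_mul hw') hε ih

end Tensor

/-! ### The couplings in the Bell basis -/

section Bell

/-- The matrices of `R¹` and `R³` in the Bell basis of `ℂ² ⊗ ℂ²`. -/
def bellSpinInt : Fin 2 → Matrix (Fin 2 × Fin 2) (Fin 2 × Fin 2) ℤ
  | 0 => fun p q => if p.2 = 0 ∧ q.2 = 0 ∧ p.1 ≠ q.1 then 1 else 0
  | 1 => fun p q => if p.1 = 0 ∧ q.1 = 0 ∧ p.2 ≠ q.2 then 1 else 0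

/-- Twice the recoupling matrix between the Bell bases of the two ways of pairing four
spins one half. -/
def recouplingInt :
    Matrix ((Fin 2 × Fin 2) × (Fin 2 × Fin 2)) ((Fin 2 × Fin 2) × (Fin 2 × Fin 2)) ℤ :=
  fun a b => if a.1 + a.2 = b.1 + b.2 then
    (-1) ^ (a.2.2.val * b.1.1.val + b.2.2.val * a.1.1.val) else 0

/-- The projection onto the singlet in the Bell basis. -/
def bellSingletInt : Matrix (Fin 2 × Fin 2) (Fin 2 × Fin 2) ℤ := Matrix.single (1, 1) (1, 1) 1

/-- The matrix all of whose entries are one. -/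
def allOnesInt : Matrix (Fin 2 × Fin 2) (Fin 2 × Fin 2) ℤ := Matrix.of fun _ _ => 1

theorem recouplingInt_mul_transpose : recouplingInt * recouplingIntᵀ = (4 : ℤ) • 1 := by
  decide +kernel

theorem recouplingInt_transpose_mul : recouplingIntᵀ * recouplingInt = (4 : ℤ) • 1 := by
  decide +kernel

theorem recouplingInt_conj_add_nonneg : ∀ i a b, 0 ≤ (recouplingInt *
    (bellSpinInt i ⊗ₖ (1 : Matrix (Fin 2 × Fin 2) (Fin 2 × Fin 2) ℤ) +
      (1 : Matrix (Fin 2 × Fin 2) (Fin 2 × Fin 2) ℤ) ⊗ₖ bellSpinInt i) *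
    recouplingIntᵀ : Matrix _ _ ℤ) a b := by decide +kernel

/-- The sign with which `Rⁱ ⊗ 𝟙 - 𝟙 ⊗ Rⁱ` has nonnegative entries. -/
def spinSign (i : Fin 2) : ℤ := if i = 0 then -1 else 1

theorem recouplingInt_conj_sub_nonneg : ∀ i a b, 0 ≤ (spinSign i • (recouplingInt *
    (bellSpinInt i ⊗ₖ (1 : Matrix (Fin 2 × Fin 2) (Fin 2 × Fin 2) ℤ) -
      (1 : Matrix (Fin 2 × Fin 2) (Fin 2 × Fin 2) ℤ) ⊗ₖ bellSpinInt i) *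
    recouplingIntᵀ) : Matrix _ _ ℤ) a b := by decide +kernel

theorem bellSpinInt_anticomm_sq : ∀ i j, (if i = j then 2 else 1 : ℤ) • bellSpinInt j =
    bellSpinInt i * bellSpinInt i * bellSpinInt j +
      bellSpinInt j * (bellSpinInt i * bellSpinInt i) := by decide +kernel

theorem allOnesInt_mul_bellSpinInt_mul : ∀ i,
    allOnesInt * bellSpinInt i * allOnesInt = (2 : ℤ) • allOnesInt := by decide +kernel

theorem bellSinglet_mul_spinInt : ∀ i, bellSingletInt * bellSpinInt i = 0 := by decide +kernel

/-- The matrices of `R¹` and `R³` in the Bell basis, over `ℂ`. -/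
def bellSpin (i : Fin 2) : Matrix (Fin 2 × Fin 2) (Fin 2 × Fin 2) ℂ :=
  (bellSpinInt i).map (Int.castRingHom ℂ)

/-- The projection onto the singlet in the Bell basis, over `ℂ`. -/
def bellSinglet : Matrix (Fin 2 × Fin 2) (Fin 2 × Fin 2) ℂ :=
  bellSingletInt.map (Int.castRingHom ℂ)

/-- The matrix all of whose entries are one, over `ℂ`. -/
def allOnes : Matrix (Fin 2 × Fin 2) (Fin 2 × Fin 2) ℂ :=
  allOnesInt.map (Int.castRingHom ℂ)

/-- The recoupling matrix. -/
def recoupling :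
    Matrix ((Fin 2 × Fin 2) × (Fin 2 × Fin 2)) ((Fin 2 × Fin 2) × (Fin 2 × Fin 2)) ℂ :=
  (1 / 2 : ℂ) • recouplingInt.map (Int.castRingHom ℂ)

theorem map_intCast_nonneg {n : Type*} {A : Matrix n n ℤ} (h : ∀ i j, 0 ≤ A i j) (i j : n) :
    0 ≤ A.map (Int.castRingHom ℂ) i j := by
  have : (0 : ℂ) ≤ ((A i j : ℤ) : ℂ) := by exact_mod_cast h i j
  exact this

theorem bellSpinInt_nonneg : ∀ i p q, 0 ≤ bellSpinInt i p q := by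
  intro i p q
  fin_cases i <;> simp only [bellSpinInt] <;> split_ifs <;> norm_num

theorem bellSpin_nonneg (i : Fin 2) : ∀ p q, 0 ≤ bellSpin i p q :=
  map_intCast_nonneg (bellSpinInt_nonneg i)

theorem conjTranspose_map_intCast {m n : Type*} (A : Matrix m n ℤ) :
    (A.map (Int.castRingHom ℂ))ᴴ = Aᵀ.map (Int.castRingHom ℂ) := by
  ext i j
  simp [conjTranspose_apply]

theorem bellSpin_isHermitian (i : Fin 2) : (bellSpin i).IsHermitian := by
  rw [IsHermitian, bellSpin, conjTranspose_map_intCast,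
    (by decide : ∀ i, (bellSpinInt i)ᵀ = bellSpinInt i) i]

theorem recoupling_conjTranspose :
    recouplingᴴ = (1 / 2 : ℂ) • recouplingIntᵀ.map (Int.castRingHom ℂ) := by
  rw [recoupling, conjTranspose_smul, conjTranspose_map_intCast]
  simp

theorem matrix_map_intCast_smul {m n : Type*} (z : ℤ) (A : Matrix m n ℤ) :
    (z • A).map (Int.castRingHom ℂ) = (z : ℂ) • A.map (Int.castRingHom ℂ) := by
  ext i j
  simp only [Matrix.map_apply, Matrix.smul_apply, smul_eq_mul, map_mul, eq_intCast]

theorem map_intCast_one {n : Type*} [DecidableEq n] :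
    (1 : Matrix n n ℤ).map (Int.castRingHom ℂ) = 1 :=
  Matrix.map_one _ (map_zero _) (map_one _)

theorem recoupling_mul_conjTranspose : recoupling * recouplingᴴ = 1 := by
  rw [recoupling_conjTranspose, recoupling, smul_mul_smul_comm, ← Matrix.map_mul,
    recouplingInt_mul_transpose, matrix_map_intCast_smul, map_intCast_one, smul_smul]
  norm_num

theorem recoupling_conjTranspose_mul : recouplingᴴ * recoupling = 1 := by
  rw [recoupling_conjTranspose, recoupling, smul_mul_smul_comm, ← Matrix.map_mul,
    recouplingInt_transpose_mul, matrix_map_intCast_smul, map_intCast_one, smul_smul]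
  norm_num

theorem kronecker_map_one (i : Fin 2) :
    bellSpin i ⊗ₖ (1 : Matrix (Fin 2 × Fin 2) (Fin 2 × Fin 2) ℂ) =
      (bellSpinInt i ⊗ₖ (1 : Matrix (Fin 2 × Fin 2) (Fin 2 × Fin 2) ℤ)).map
        (Int.castRingHom ℂ) := by
  ext p q
  simp [bellSpin, one_apply, apply_ite (Int.cast : ℤ → ℂ)]

theorem one_kronecker_map (i : Fin 2) :
    (1 : Matrix (Fin 2 × Fin 2) (Fin 2 × Fin 2) ℂ) ⊗ₖ bellSpin i =
      ((1 : Matrix (Fin 2 × Fin 2) (Fin 2 × Fin 2) ℤ) ⊗ₖ bellSpinInt i).map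
        (Int.castRingHom ℂ) := by
  ext p q
  simp [bellSpin, one_apply, apply_ite (Int.cast : ℤ → ℂ)]

theorem bellSpin_isFerro (i : Fin 2) : IsFerro recoupling (spinSign i : ℂ) (bellSpin i) := by
  have hquarter : (0 : ℂ) ≤ 1 / 2 * (1 / 2) := mul_nonneg half_nonneg_complex half_nonneg_complex
  constructor
  · have h : recoupling * doubleAdd (bellSpin i) * recouplingᴴ =
        (1 / 2 * (1 / 2) : ℂ) • (recouplingInt *
          (bellSpinInt i ⊗ₖ (1 : Matrix (Fin 2 × Fin 2) (Fin 2 × Fin 2) ℤ) +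
            (1 : Matrix (Fin 2 × Fin 2) (Fin 2 × Fin 2) ℤ) ⊗ₖ bellSpinInt i) *
          recouplingIntᵀ : Matrix _ _ ℤ).map (Int.castRingHom ℂ) := by
      rw [doubleAdd, kronecker_map_one, one_kronecker_map, recoupling_conjTranspose, recoupling,
        ← Matrix.map_add _ (map_add _), Matrix.smul_mul, smul_mul_smul_comm, ← Matrix.map_mul,
        ← Matrix.map_mul]
    intro a b
    rw [h]
    exact mul_nonneg hquarter (map_intCast_nonneg (recouplingInt_conj_add_nonneg i) a b)
  · have h : (spinSign i : ℂ) • (recoupling * doubleSub (bellSpin i) * recouplingᴴ) =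
        (1 / 2 * (1 / 2) : ℂ) • (spinSign i • (recouplingInt *
          (bellSpinInt i ⊗ₖ (1 : Matrix (Fin 2 × Fin 2) (Fin 2 × Fin 2) ℤ) -
            (1 : Matrix (Fin 2 × Fin 2) (Fin 2 × Fin 2) ℤ) ⊗ₖ bellSpinInt i) *
          recouplingIntᵀ) : Matrix _ _ ℤ).map (Int.castRingHom ℂ) := by
      rw [doubleSub, kronecker_map_one, one_kronecker_map, recoupling_conjTranspose, recoupling,
        ← Matrix.map_sub _ (map_sub _), Matrix.smul_mul, smul_mul_smul_comm, ← Matrix.map_mul,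
        ← Matrix.map_mul, smul_comm, matrix_map_intCast_smul]
    intro a b
    rw [h]
    exact mul_nonneg hquarter (map_intCast_nonneg (recouplingInt_conj_sub_nonneg i) a b)

theorem spinSign_mul_self (i : Fin 2) : (spinSign i : ℂ) * (spinSign i : ℂ) = 1 := by
  exact_mod_cast (by decide : ∀ i, spinSign i * spinSign i = 1) i

theorem bellSpin_anticomm_sq (i j : Fin 2) : (if i = j then 2 else 1 : ℂ) • bellSpin j =
    bellSpin i * bellSpin i * bellSpin j + bellSpin j * (bellSpin i * bellSpin i) := by
  have h := congrArg (fun A => A.map (Int.castRingHom ℂ)) (bellSpinInt_anticomm_sq i j)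
  simp only [Matrix.map_add _ (map_add _), Matrix.map_mul, matrix_map_intCast_smul] at h
  rw [bellSpin, bellSpin, ← h]
  split_ifs <;> simp

theorem allOnes_mul_bellSpin_mul (i : Fin 2) :
    allOnes * bellSpin i * allOnes = (2 : ℂ) • allOnes := by
  rw [allOnes, bellSpin, ← Matrix.map_mul, ← Matrix.map_mul, allOnesInt_mul_bellSpinInt_mul,
    matrix_map_intCast_smul]
  simp

theorem bellSinglet_mul_spin (i : Fin 2) : bellSinglet * bellSpin i = 0 := by
  rw [bellSpin, bellSinglet, ← Matrix.map_mul, bellSinglet_mul_spinInt]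
  ext p q
  simp

end Bell

/-! ### Ground states of ferromagnetic couplings in the Bell basis -/

section Couple

variable {ι : Type*} [Fintype ι] [DecidableEq ι]

/-- The sum over `i` and `A` of `J i A` times the product of the `Rⁱ` over the sites of `A`,
in the Bell basis. -/
def couple (J : Fin 2 → Finset ι → ℝ) : Matrix (ι → Fin 2 × Fin 2) (ι → Fin 2 × Fin 2) ℂ :=
  ∑ i, ∑ A, (J i A : ℂ) • siteProd (bellSpin i) A

/-- The couplings of the sets that do not contain `x`. -/
def avoiding (J : Fin 2 → Finset ι → ℝ) (x : ι) : Fin 2 → Finset ι → ℝ :=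
  fun i A => if x ∈ A then 0 else J i A

/-- The couplings of the sets that contain `x`. -/
def meeting (J : Fin 2 → Finset ι → ℝ) (x : ι) : Fin 2 → Finset ι → ℝ :=
  fun i A => if x ∈ A then J i A else 0

theorem couple_sub_avoiding (J : Fin 2 → Finset ι → ℝ) (x : ι) :
    couple J - couple (avoiding J x) = couple (meeting J x) := by
  simp only [couple, ← Finset.sum_sub_distrib, ← sub_smul]
  refine Finset.sum_congr rfl fun i _ => Finset.sum_congr rfl fun A _ => ?_
  by_cases h : x ∈ A <;> simp [avoiding, meeting, h]

theorem avoiding_nonneg {J : Fin 2 → Finset ι → ℝ} (hJ : ∀ i A, 0 ≤ J i A) (x : ι) (i : Fin 2)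
    (A : Finset ι) : 0 ≤ avoiding J x i A := by
  unfold avoiding
  split_ifs
  exacts [le_rfl, hJ i A]

theorem meeting_nonneg {J : Fin 2 → Finset ι → ℝ} (hJ : ∀ i A, 0 ≤ J i A) (x : ι) (i : Fin 2)
    (A : Finset ι) : 0 ≤ meeting J x i A := by
  unfold meeting
  split_ifs
  exacts [hJ i A, le_rfl]

theorem couple_mulVec (J : Fin 2 → Finset ι → ℝ) (u : (ι → Fin 2 × Fin 2) → ℂ) :
    couple J *ᵥ u = ∑ i, ∑ A, (J i A : ℂ) • (siteProd (bellSpin i) A *ᵥ u) := by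
  simp only [couple, sum_mulVec, smul_mulVec]

theorem couple_nonneg {J : Fin 2 → Finset ι → ℝ} (hJ : ∀ i A, 0 ≤ J i A)
    (f g : ι → Fin 2 × Fin 2) : 0 ≤ couple J f g := by
  simp only [couple, Matrix.sum_apply, Matrix.smul_apply, smul_eq_mul]
  exact Finset.sum_nonneg fun i _ => Finset.sum_nonneg fun A _ =>
    mul_nonneg (by exact_mod_cast hJ i A) (siteProd_nonneg (bellSpin_nonneg i) A f g)

theorem couple_isHermitian (J : Fin 2 → Finset ι → ℝ) : (couple J).IsHermitian := by
  simp only [IsHermitian, couple, conjTranspose_sum, conjTranspose_smul]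
  refine Finset.sum_congr rfl fun i _ => Finset.sum_congr rfl fun A _ => ?_
  rw [(siteProd_isHermitian (bellSpin_isHermitian i) A).eq]
  simp

theorem couple_commute {J : Fin 2 → Finset ι → ℝ}
    {M : Matrix (ι → Fin 2 × Fin 2) (ι → Fin 2 × Fin 2) ℂ}
    (h : ∀ i A, J i A ≠ 0 → M * siteProd (bellSpin i) A = siteProd (bellSpin i) A * M) :
    M * couple J = couple J * M := by
  simp only [couple, Finset.mul_sum, Finset.sum_mul, Matrix.mul_smul, Matrix.smul_mul]
  refine Finset.sum_congr rfl fun i _ => Finset.sum_congr rfl fun A _ => ?_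
  by_cases hJ : J i A = 0
  · simp [hJ]
  · rw [h i A hJ]

theorem siteProd_mul_couple_avoiding (J : Fin 2 → Finset ι → ℝ) (x : ι)
    (σ : Matrix (Fin 2 × Fin 2) (Fin 2 × Fin 2) ℂ) :
    siteProd σ {x} * couple (avoiding J x) = couple (avoiding J x) * siteProd σ {x} := by
  refine couple_commute fun i A h => siteProd_commute_of_disjoint σ _ ?_
  by_contra hx
  rw [Finset.disjoint_singleton_left, not_not] at hx
  simp [avoiding, hx] at h

theorem doubleAdd_couple_nonneg {J : Fin 2 → Finset ι → ℝ} (hJ : ∀ i A, 0 ≤ J i A) :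
    ∀ a b, 0 ≤ (doubleTensor ι recoupling * doubleAdd (couple J) *
      (doubleTensor ι recoupling)ᴴ) a b := by
  have h : doubleAdd (couple J) = ∑ i, ∑ A, (J i A : ℂ) • doubleAdd (siteProd (bellSpin i) A) := by
    ext p q
    simp only [doubleAdd, couple, Matrix.add_apply, kroneckerMap_apply, Matrix.sum_apply,
      Matrix.smul_apply, smul_eq_mul, Finset.mul_sum, Finset.sum_mul, ← Finset.sum_add_distrib]
    exact Finset.sum_congr rfl fun i _ => Finset.sum_congr rfl fun A _ => by ring
  intro a b
  rw [h]
  simp only [Matrix.mul_sum, Matrix.sum_mul, Matrix.mul_smul, Matrix.smul_mul, Matrix.sum_apply,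
    Matrix.smul_apply, smul_eq_mul]
  exact Finset.sum_nonneg fun i _ => Finset.sum_nonneg fun A _ =>
    mul_nonneg (by exact_mod_cast hJ i A) ((IsFerro.siteProd recoupling_mul_conjTranspose
      recoupling_conjTranspose_mul (spinSign_mul_self i) (bellSpin_isFerro i) A).1 a b)

theorem mulVec_nonneg {n : Type*} [Fintype n] {A : Matrix n n ℂ} (hA : ∀ i j, 0 ≤ A i j)
    {u : n → ℂ} (hu : ∀ i, 0 ≤ u i) (i : n) : 0 ≤ (A *ᵥ u) i :=
  Finset.sum_nonneg fun j _ => mul_nonneg (hA i j) (hu j)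

theorem siteProd_mulVec_eq_zero_of_couple {J : Fin 2 → Finset ι → ℝ} (hJ : ∀ i A, 0 ≤ J i A)
    {u : (ι → Fin 2 × Fin 2) → ℂ} (hu : ∀ f, 0 ≤ u f) (h : couple J *ᵥ u = 0) {i : Fin 2}
    {A : Finset ι} (hA : 0 < J i A) : siteProd (bellSpin i) A *ᵥ u = 0 := by
  have hnn : ∀ j B f, 0 ≤ (J j B : ℂ) * (siteProd (bellSpin j) B *ᵥ u) f := fun j B f =>
    mul_nonneg (by exact_mod_cast hJ j B)
      (mulVec_nonneg (siteProd_nonneg (bellSpin_nonneg j) B) hu f)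
  funext f
  have h0 := congrFun h f
  simp only [couple_mulVec, Finset.sum_apply, Pi.smul_apply, smul_eq_mul, Pi.zero_apply] at h0
  have h1 := (Finset.sum_eq_zero_iff_of_nonneg
    fun j _ => Finset.sum_nonneg fun B _ => hnn j B f).1 h0 i (Finset.mem_univ i)
  have h2 := (Finset.sum_eq_zero_iff_of_nonneg fun B _ => hnn i B f).1 h1 A (Finset.mem_univ A)
  exact (mul_eq_zero.1 h2).resolve_left (by exact_mod_cast hA.ne')

theorem posSemidef_avoiding {J : Fin 2 → Finset ι → ℝ} (hJ : ∀ i A, 0 ≤ J i A) {l : ℝ}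
    (hl : ((l : ℂ) • (1 : Matrix (ι → Fin 2 × Fin 2) (ι → Fin 2 × Fin 2) ℂ) -
      couple J).PosSemidef) (x : ι) :
    ((l : ℂ) • (1 : Matrix (ι → Fin 2 × Fin 2) (ι → Fin 2 × Fin 2) ℂ) -
      couple (avoiding J x)).PosSemidef :=
  posSemidef_of_entries_le (couple_nonneg (avoiding_nonneg hJ x))
    (by rw [couple_sub_avoiding]; exact couple_nonneg (meeting_nonneg hJ x))
    (couple_isHermitian _) hl

theorem eigenvector_of_avoiding {J : Fin 2 → Finset ι → ℝ} (hJ : ∀ i A, 0 ≤ J i A) {l : ℝ}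
    (hl : ((l : ℂ) • (1 : Matrix (ι → Fin 2 × Fin 2) (ι → Fin 2 × Fin 2) ℂ) -
      couple J).PosSemidef) {x : ι} {u : (ι → Fin 2 × Fin 2) → ℂ} (hu0 : ∀ f, 0 ≤ u f)
    (hu : couple (avoiding J x) *ᵥ u = (l : ℂ) • u) : couple J *ᵥ u = (l : ℂ) • u :=
  eigenvector_of_entries_le
    (by rw [couple_sub_avoiding]; exact couple_nonneg (meeting_nonneg hJ x)) hl hu0 hu

/-- If `Rⁱ` at `x` annihilates `u`, then every product of couplings over a set containing `x` has
vanishing expectation in `u`. -/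
theorem form_siteProd_eq_zero {i : Fin 2} {x : ι} {u : (ι → Fin 2 × Fin 2) → ℂ}
    (hu : siteProd (bellSpin i) {x} *ᵥ u = 0) (j : Fin 2) {A : Finset ι} (hA : x ∈ A) :
    star u ⬝ᵥ siteProd (bellSpin j) A *ᵥ u = 0 := by
  set R := siteProd (bellSpin i) {x} with hR
  have hc : (if i = j then 2 else 1 : ℂ) ≠ 0 := by split_ifs <;> norm_num
  have hdec : (if i = j then 2 else 1 : ℂ) • siteProd (bellSpin j) A =
      R * (R * siteProd (bellSpin j) A) +
        siteProd (bellSpin j) {x} * siteProd (bellSpin j) (A.erase x) * R * R := by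
    have h1 : (if i = j then 2 else 1 : ℂ) • siteProd (bellSpin j) {x} =
        R * R * siteProd (bellSpin j) {x} + siteProd (bellSpin j) {x} * (R * R) := by
      rw [← siteProd_smul, bellSpin_anticomm_sq, siteProd_add]
      simp only [siteProd_mul, hR]
    have h2 : R * siteProd (bellSpin j) (A.erase x) = siteProd (bellSpin j) (A.erase x) * R :=
      siteProd_commute_of_disjoint _ _ (by simp)
    rw [siteProd_erase (bellSpin j) hA, ← Matrix.smul_mul, h1, add_mul]
    simp only [Matrix.mul_assoc]
    rw [h2, ← Matrix.mul_assoc R (siteProd (bellSpin j) (A.erase x)) R, h2, Matrix.mul_assoc]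
  have hRh : Rᴴ = R := siteProd_isHermitian (bellSpin_isHermitian i) {x}
  have hleft : ∀ v, star u ⬝ᵥ R *ᵥ v = 0 := fun v => by
    rw [dotProduct_mulVec, ← hRh, ← star_mulVec, hu, star_zero, zero_dotProduct]
  have h3 : (if i = j then 2 else 1 : ℂ) * (star u ⬝ᵥ siteProd (bellSpin j) A *ᵥ u) = 0 := by
    rw [← smul_eq_mul, ← dotProduct_smul, ← smul_mulVec, hdec, add_mulVec, dotProduct_add,
      ← mulVec_mulVec u R, hleft, ← mulVec_mulVec u _ R, hu, mulVec_zero, dotProduct_zero, add_zero]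
  exact (mul_eq_zero.1 h3).resolve_left hc

theorem exists_siteProd_singleton_ne_zero {J : Fin 2 → Finset ι → ℝ} (hJ : ∀ i A, 0 ≤ J i A)
    {l : ℝ} (hl : ((l : ℂ) • (1 : Matrix (ι → Fin 2 × Fin 2) (ι → Fin 2 × Fin 2) ℂ) -
      couple J).PosSemidef) {v : (ι → Fin 2 × Fin 2) → ℂ} (hv0 : v ≠ 0)
    (hv : couple J *ᵥ v = (l : ℂ) • v) (i : Fin 2) (x : ι) :
    ∃ u, couple J *ᵥ u = (l : ℂ) • u ∧ siteProd (bellSpin i) {x} *ᵥ u ≠ 0 := by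
  by_contra! hcon
  have hΦ := eigenvector_modulus (couple_nonneg hJ) hl hv
  have hΦn := modulus_dotProduct_self v
  have hΦ0 := modulus_nonneg v
  set Φ := modulus v
  have hform : star Φ ⬝ᵥ couple (meeting J x) *ᵥ Φ = 0 := by
    simp only [couple_mulVec, dotProduct_sum, dotProduct_smul]
    refine Finset.sum_eq_zero fun j _ => Finset.sum_eq_zero fun A _ => ?_
    by_cases hA : x ∈ A
    · rw [form_siteProd_eq_zero (hcon Φ hΦ) j hA, smul_zero]
    · simp [meeting, hA]
  have hΦx : couple (avoiding J x) *ᵥ Φ = (l : ℂ) • Φ := by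
    refine eigenvector_of_le_form (posSemidef_avoiding hJ hl x) (le_of_eq ?_)
    rw [← couple_sub_avoiding, sub_mulVec, dotProduct_sub, sub_eq_zero] at hform
    rw [← hform, hΦ, dotProduct_smul, smul_eq_mul]
  set P := siteProd allOnes {x} with hP
  have hones : ∀ p q, allOnes p q = 1 := fun p q => by simp [allOnes, allOnesInt]
  have hPh : Pᴴ = P := siteProd_isHermitian (by ext p q; simp [hones]) {x}
  have hPΦ : couple (avoiding J x) *ᵥ (P *ᵥ Φ) = (l : ℂ) • (P *ᵥ Φ) := by
    rw [mulVec_mulVec, ← siteProd_mul_couple_avoiding, ← mulVec_mulVec, hΦx, mulVec_smul]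
  have hRP := hcon _ (eigenvector_of_avoiding hJ hl
    (mulVec_nonneg (siteProd_nonneg (fun p q => by rw [hones]; exact zero_le_one) {x}) hΦ0) hPΦ)
  have hPRP : P * siteProd (bellSpin i) {x} * P = (2 : ℂ) • P := by
    rw [hP, ← siteProd_mul, ← siteProd_mul, allOnes_mul_bellSpin_mul, siteProd_smul]
  have hPzero : P *ᵥ Φ = 0 := by
    have : (2 : ℂ) • (P *ᵥ Φ) = 0 := by
      rw [← smul_mulVec, ← hPRP, ← mulVec_mulVec, ← mulVec_mulVec, hRP, mulVec_zero]
    exact (smul_eq_zero.1 this).resolve_left two_ne_zero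
  have hP1 : ∀ f g, 0 ≤ (P - 1) f g := by
    rw [hP, ← siteProd_one {x}, ← siteProd_sub]
    refine siteProd_nonneg (fun p q => ?_) {x}
    rw [Matrix.sub_apply, hones, one_apply]
    split_ifs <;> simp
  have hle := form_nonneg hP1 hΦ0
  rw [sub_mulVec, one_mulVec, hPzero, zero_sub, dotProduct_neg, hΦn] at hle
  exact hv0 (dotProduct_star_self_eq_zero.1 (le_antisymm (neg_nonneg.1 hle)
    (dotProduct_star_self_nonneg v)))

theorem exists_siteProd_ne_zero {J : Fin 2 → Finset ι → ℝ} (hJ : ∀ i A, 0 ≤ J i A)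
    {l : ℝ} (hl : ((l : ℂ) • (1 : Matrix (ι → Fin 2 × Fin 2) (ι → Fin 2 × Fin 2) ℂ) -
      couple J).PosSemidef) {v : (ι → Fin 2 × Fin 2) → ℂ} (hv0 : v ≠ 0)
    (hv : couple J *ᵥ v = (l : ℂ) • v) (i : Fin 2) (K : Finset ι) :
    ∃ u, couple J *ᵥ u = (l : ℂ) • u ∧ siteProd (bellSpin i) K *ᵥ u ≠ 0 := by
  induction K using Finset.induction_on with
  | empty => exact ⟨v, hv, by rwa [siteProd_empty, one_mulVec]⟩
  | insert x K hx ih =>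
    obtain ⟨u, hu, hu0⟩ := exists_siteProd_singleton_ne_zero hJ hl hv0 hv i x
    obtain ⟨w, hw, hw0⟩ := ih
    have hferro : ∀ A : Finset ι,
        IsFerro (doubleTensor ι recoupling) (spinSign i : ℂ) (siteProd (bellSpin i) A) :=
      IsFerro.siteProd recoupling_mul_conjTranspose recoupling_conjTranspose_mul
        (spinSign_mul_self i) (bellSpin_isFerro i)
    rw [siteProd_insert _ hx]
    exact IsFerro.exists_mul_mulVec_ne_zero
      (doubleTensor_conjTranspose_mul recoupling_conjTranspose_mul)
      (doubleTensor_mul_conjTranspose recoupling_mul_conjTranspose) (spinSign_mul_self i)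
      (doubleAdd_couple_nonneg hJ) hl (hferro {x}) (hferro K)
      (siteProd_isHermitian (bellSpin_isHermitian i) _)
      (siteProd_isHermitian (bellSpin_isHermitian i) _)
      (siteProd_commute_of_disjoint _ _ (Finset.disjoint_singleton_left.2 hx)) hu hw hu0 hw0

theorem mulVec_modulus_ne_zero {n : Type*} [Fintype n] {A : Matrix n n ℂ}
    (hA : ∀ i j, 0 ≤ A i j) {v : n → ℂ} (hv : A *ᵥ v ≠ 0) : A *ᵥ modulus v ≠ 0 := by
  contrapose! hv
  funext i
  have h := congrFun hv i
  have h1 := (Finset.sum_eq_zero_iff_of_nonneg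
    fun j _ => mul_nonneg (hA i j) (modulus_nonneg v j)).1 h
  refine Finset.sum_eq_zero fun j hj => ?_
  rcases mul_eq_zero.1 (h1 j hj) with h2 | h2
  · simp [h2]
  · have : v j = 0 := by simpa [modulus] using h2
    simp [this]

/-- Top eigenvectors of a nonnegative coupling have no singlet at a site that is met by one of
the couplings. -/
theorem siteProd_bellSinglet_mulVec_eq_zero {J : Fin 2 → Finset ι → ℝ} (hJ : ∀ i A, 0 ≤ J i A)
    {l : ℝ} (hl : ((l : ℂ) • (1 : Matrix (ι → Fin 2 × Fin 2) (ι → Fin 2 × Fin 2) ℂ) -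
      couple J).PosSemidef) {ψ : (ι → Fin 2 × Fin 2) → ℂ}
    (hψ : couple J *ᵥ ψ = (l : ℂ) • ψ) {x : ι} {i : Fin 2} {A : Finset ι} (hxA : x ∈ A)
    (hJA : 0 < J i A) : siteProd bellSinglet {x} *ᵥ ψ = 0 := by
  by_contra hne
  have hkill : siteProd bellSinglet {x} * couple (meeting J x) = 0 := by
    simp only [couple, Finset.mul_sum, Matrix.mul_smul]
    refine Finset.sum_eq_zero fun j _ => Finset.sum_eq_zero fun B _ => ?_
    by_cases hB : x ∈ B
    · rw [siteProd_erase _ hB, ← Matrix.mul_assoc, ← siteProd_mul, bellSinglet_mul_spin,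
        ← zero_smul ℂ (0 : Matrix (Fin 2 × Fin 2) (Fin 2 × Fin 2) ℂ), siteProd_smul, zero_smul,
        Matrix.zero_mul, smul_zero]
    · simp [meeting, hB]
  have hψx : couple (avoiding J x) *ᵥ (siteProd bellSinglet {x} *ᵥ ψ) =
      (l : ℂ) • (siteProd bellSinglet {x} *ᵥ ψ) := by
    rw [mulVec_mulVec, ← siteProd_mul_couple_avoiding, ← mulVec_smul, ← hψ, mulVec_mulVec]
    rw [← couple_sub_avoiding, Matrix.mul_sub, sub_eq_zero] at hkill
    rw [hkill]
  have hl' := posSemidef_avoiding hJ hl x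
  obtain ⟨φ, hφ, hφ0⟩ := exists_siteProd_ne_zero (avoiding_nonneg hJ x) hl' hne hψx i Finset.univ
  have hΦ := eigenvector_modulus (couple_nonneg (avoiding_nonneg hJ x)) hl' hφ
  refine mulVec_modulus_ne_zero (siteProd_nonneg (bellSpin_nonneg i) _) hφ0 ?_
  have hmeet : couple (meeting J x) *ᵥ modulus φ = 0 := by
    rw [← couple_sub_avoiding, sub_mulVec, hΦ,
      eigenvector_of_avoiding hJ hl (modulus_nonneg φ) hΦ, sub_self]
  have hA := siteProd_mulVec_eq_zero_of_couple (meeting_nonneg hJ x) (modulus_nonneg φ) hmeet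
    (i := i) (A := A) (by simpa [meeting, hxA] using hJA)
  rw [← Finset.sdiff_union_of_subset (Finset.subset_univ A),
    siteProd_union _ Finset.sdiff_disjoint, ← mulVec_mulVec, hA, mulVec_zero]

end Couple

/-! ### Change to the Bell basis -/

section BellBasis

/-- The matrix of the change to the Bell basis. -/
def bellBasis : Matrix (Fin 2 × Fin 2) (Fin 2 × Fin 2) ℂ :=
  fun p q => if q.1 + q.2 = p.1 then (-1) ^ (p.2.val * q.1.val) * (Real.sqrt 2 : ℂ)⁻¹ else 0

theorem sqrt_two_inv_mul_self : (Real.sqrt 2 : ℂ)⁻¹ * (Real.sqrt 2 : ℂ)⁻¹ = 1 / 2 := by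
  rw [← mul_inv, ← Complex.ofReal_mul, Real.mul_self_sqrt zero_le_two]
  norm_num

theorem bellBasis_mul_conjTranspose : bellBasis * bellBasisᴴ = 1 := by
  have h := sqrt_two_inv_mul_self
  ext ⟨a, b⟩ ⟨c, d⟩
  fin_cases a <;> fin_cases b <;> fin_cases c <;> fin_cases d <;>
    simp [mul_apply, Fintype.sum_prod_type, bellBasis, conjTranspose_apply, one_apply] <;>
    grind

theorem bellSpin_apply (i : Fin 2) (p q : Fin 2 × Fin 2) :
    bellSpin i p q = ((bellSpinInt i p q : ℤ) : ℂ) := rfl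

theorem bellSinglet_apply (p q : Fin 2 × Fin 2) :
    bellSinglet p q = if (1, 1) = p ∧ (1, 1) = q then 1 else 0 := by
  simp [bellSinglet, bellSingletInt, Matrix.single, apply_ite (Int.cast : ℤ → ℂ)]

theorem bellBasis_conj_Rop1 : bellBasis * Rop pauli1 * bellBasisᴴ = bellSpin 0 := by
  have h := sqrt_two_inv_mul_self
  ext ⟨a, b⟩ ⟨c, d⟩
  fin_cases a <;> fin_cases b <;> fin_cases c <;> fin_cases d <;>
    simp [mul_apply, Fintype.sum_prod_type, bellBasis, conjTranspose_apply, one_apply, Rop,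
      pauli1, bellSpin_apply, bellSpinInt] <;>
    grind

theorem bellBasis_conj_Rop3 : bellBasis * Rop pauli3 * bellBasisᴴ = bellSpin 1 := by
  have h := sqrt_two_inv_mul_self
  ext ⟨a, b⟩ ⟨c, d⟩
  fin_cases a <;> fin_cases b <;> fin_cases c <;> fin_cases d <;>
    simp [mul_apply, Fintype.sum_prod_type, bellBasis, conjTranspose_apply, one_apply, Rop,
      pauli3, bellSpin_apply, bellSpinInt] <;>
    grind

theorem bellBasis_conj_Ptrip : bellBasis * Ptrip * bellBasisᴴ = 1 - bellSinglet := by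
  have h := sqrt_two_inv_mul_self
  ext ⟨a, b⟩ ⟨c, d⟩
  fin_cases a <;> fin_cases b <;> fin_cases c <;> fin_cases d <;>
    simp [mul_apply, Fintype.sum_prod_type, bellBasis, conjTranspose_apply, one_apply, Ptrip,
      singlet, vecMulVec, bellSinglet_apply] <;>
    grind

variable {ι : Type*} [Fintype ι] [DecidableEq ι]

/-- The matrix of the change to the Bell basis at every site. -/
def bellTensor (ι : Type*) [Fintype ι] : Matrix (ι → Fin 2 × Fin 2) (ι → Fin 2 × Fin 2) ℂ :=
  tensor fun _ : ι => bellBasis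

theorem bellTensor_mul_conjTranspose : bellTensor ι * (bellTensor ι)ᴴ = 1 := by
  simp only [bellTensor, tensor_conjTranspose, tensor_mul, bellBasis_mul_conjTranspose, tensor_one]

theorem bellTensor_conjTranspose_mul : (bellTensor ι)ᴴ * bellTensor ι = 1 :=
  mul_eq_one_comm.1 bellTensor_mul_conjTranspose

theorem bellTensor_conj_siteProd (σ : Matrix (Fin 2 × Fin 2) (Fin 2 × Fin 2) ℂ) (A : Finset ι) :
    bellTensor ι * siteProd σ A * (bellTensor ι)ᴴ = siteProd (bellBasis * σ * bellBasisᴴ) A :=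
  tensor_conj_siteProd bellBasis_mul_conjTranspose σ A

theorem bellTensor_conj_hamR (J1 J3 : Finset ι → ℝ) :
    bellTensor ι * hamR J1 J3 * (bellTensor ι)ᴴ = -couple ![J1, J3] := by
  simp only [hamR, couple, Fin.sum_univ_two, Matrix.mul_neg, Matrix.neg_mul, Matrix.mul_sum,
    Matrix.sum_mul, Matrix.mul_add, Matrix.add_mul, Matrix.mul_smul, Matrix.smul_mul,
    bellTensor_conj_siteProd, bellBasis_conj_Rop1, bellBasis_conj_Rop3, Finset.sum_add_distrib]
  rfl

theorem bellTensor_mul_of_conj {X Y : Matrix (ι → Fin 2 × Fin 2) (ι → Fin 2 × Fin 2) ℂ}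
    (h : bellTensor ι * X * (bellTensor ι)ᴴ = Y) : bellTensor ι * X = Y * bellTensor ι := by
  rw [← h, Matrix.mul_assoc _ _ (bellTensor ι), bellTensor_conjTranspose_mul, Matrix.mul_one]

theorem hamR_isHermitian (J1 J3 : Finset ι → ℝ) : (hamR J1 J3).IsHermitian := by
  have h : hamR J1 J3 = (bellTensor ι)ᴴ * -couple ![J1, J3] * bellTensor ι := by
    rw [Matrix.mul_assoc, ← bellTensor_mul_of_conj (bellTensor_conj_hamR J1 J3),
      ← Matrix.mul_assoc, bellTensor_conjTranspose_mul, Matrix.one_mul]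
  rw [h]
  exact isHermitian_conjTranspose_mul_mul _ (couple_isHermitian _).neg

theorem posSemidef_sub_E0 {n : Type*} [Fintype n] [DecidableEq n] {M : Matrix n n ℂ}
    (hM : M.IsHermitian) : (M - (E0 M : ℂ) • (1 : Matrix n n ℂ)).PosSemidef := by
  have hfin : {t : ℝ | (t : ℂ) ∈ spectrum ℂ M}.Finite :=
    (Matrix.finite_spectrum M).preimage Complex.ofReal_injective.injOn
  rw [Matrix.posSemidef_iff_isHermitian_and_spectrum_nonneg]
  refine ⟨hM.sub ?_, fun z hz => ?_⟩
  · rw [IsHermitian, conjTranspose_smul, conjTranspose_one]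
    simp
  · rw [← Algebra.algebraMap_eq_smul_one, ← spectrum.sub_singleton_eq] at hz
    obtain ⟨w, hw, _, rfl, rfl⟩ := Set.mem_sub.1 hz
    have hw' := hw
    rw [hM.spectrum_eq_image_range] at hw'
    obtain ⟨t, _, rfl⟩ := hw'
    have ht : E0 M ≤ t := csInf_le hfin.bddBelow hw
    have ht' : (E0 M : ℂ) ≤ t := by exact_mod_cast ht
    exact sub_nonneg.2 ht'

end BellBasis

/-- if the nonnegative couplings are such that every site is
covered by some interaction term with positive coupling, then every ground-state
eigenvector of `H̃_Λ` lies in the range of the triplet projector `P^triplet_Λ`. -/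
theorem stmt_15 {ι : Type*} [Fintype ι] [DecidableEq ι]
    (J1 J3 : Finset ι → ℝ) (hJ1 : ∀ A, 0 ≤ J1 A) (hJ3 : ∀ A, 0 ≤ J3 A)
    (hcover : ∀ x : ι, ∃ A : Finset ι, x ∈ A ∧ (0 < J1 A ∨ 0 < J3 A))
    (ψ : (ι → Fin 2 × Fin 2) → ℂ)
    (hψ : (hamR J1 J3).mulVec ψ = (E0 (hamR J1 J3) : ℂ) • ψ) :
    (siteProd Ptrip (Finset.univ : Finset ι)).mulVec ψ = ψ := by
  have hJ : ∀ i A, 0 ≤ (![J1, J3] : Fin 2 → Finset ι → ℝ) i A := fun i A => by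
    fin_cases i
    exacts [hJ1 A, hJ3 A]
  have hpsd : (((-E0 (hamR J1 J3) : ℝ) : ℂ) •
      (1 : Matrix (ι → Fin 2 × Fin 2) (ι → Fin 2 × Fin 2) ℂ) - couple ![J1, J3]).PosSemidef := by
    have h := (posSemidef_sub_E0 (hamR_isHermitian J1 J3)).mul_mul_conjTranspose_same (bellTensor ι)
    rw [Matrix.mul_sub, Matrix.sub_mul, bellTensor_conj_hamR, Matrix.mul_smul, Matrix.smul_mul,
      Matrix.mul_one, bellTensor_mul_conjTranspose] at h
    convert h using 1
    push_cast
    module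
  have heig : couple ![J1, J3] *ᵥ (bellTensor ι *ᵥ ψ) =
      ((-E0 (hamR J1 J3) : ℝ) : ℂ) • (bellTensor ι *ᵥ ψ) := by
    have h := congrArg (bellTensor ι *ᵥ ·) hψ
    simp only [mulVec_mulVec, bellTensor_mul_of_conj (bellTensor_conj_hamR J1 J3), mulVec_smul,
      Matrix.neg_mul, neg_mulVec] at h
    rw [mulVec_mulVec, Complex.ofReal_neg, neg_smul, ← h, neg_neg]
  have hsite : ∀ x, siteProd (1 - bellSinglet) {x} *ᵥ (bellTensor ι *ᵥ ψ) =
      bellTensor ι *ᵥ ψ := fun x => by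
    have h : siteProd bellSinglet {x} *ᵥ (bellTensor ι *ᵥ ψ) = 0 := by
      obtain ⟨A, hx, h1 | h3⟩ := hcover x
      · exact siteProd_bellSinglet_mulVec_eq_zero hJ hpsd heig hx (i := 0) h1
      · exact siteProd_bellSinglet_mulVec_eq_zero hJ hpsd heig hx (i := 1) h3
    rw [siteProd_sub, siteProd_one, sub_mulVec, one_mulVec, h, sub_zero]
  have hall : ∀ K : Finset ι, siteProd (1 - bellSinglet) K *ᵥ (bellTensor ι *ᵥ ψ) =
      bellTensor ι *ᵥ ψ := fun K => by
    induction K using Finset.induction_on with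
    | empty => rw [siteProd_empty, one_mulVec]
    | insert x K hx ih => rw [siteProd_insert _ hx, ← mulVec_mulVec, ih, hsite]
  have h := hall Finset.univ
  rw [← bellBasis_conj_Ptrip, mulVec_mulVec,
    ← bellTensor_mul_of_conj (bellTensor_conj_siteProd Ptrip Finset.univ)] at h
  have h' := congrArg ((bellTensor ι)ᴴ *ᵥ ·) h
  simpa only [mulVec_mulVec, ← Matrix.mul_assoc, bellTensor_conjTranspose_mul, Matrix.one_mul,
    one_mulVec] using h'

end
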